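/- arXiv:2411.05385 — 4 statements merged into one kernel-verified Lean document; each statement's English description precedes it below -/
import Mathlib

section
/- Let K ∈ ℂ^{n×n} with n = n₁+⋯+n_d and let c ∈ ℂ be nonzero. If there exists an invertible block diagonal matrix S = ⊕_{j=1}^d S_j with S_j ∈ ℂ^{n_j×n_j} such that S⁻¹KS is a strict J-contraction for some diagonal signature matrix J, then for every m ∈ ℕ and every d-tuple (U₁,…,U_d) of m×m unitary matrices, c·det(I_n ⊗ I_m − (K ⊗ I_m)(⊕_{j=1}^d I_{n_j} ⊗ U_j)) ≠ 0. -/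
open Matrix Kronecker
open scoped ComplexOrder

/-- The index type for the block decomposition `n = n₁ + ⋯ + n_d`:
`BIdx nn ≃ Fin (n₁ + ⋯ + n_d)`. -/
abbrev BIdx {d : ℕ} (nn : Fin d → ℕ) : Type := (j : Fin d) × Fin (nn j)

/-- The block diagonal matrix `⊕_{j=1}^d I_{n_j} ⊗ U_j` acting on `ℂ^{n m}`. -/
def oplusKron {d : ℕ} (nn : Fin d → ℕ) {m : ℕ}
    (U : ∀ _ : Fin d, Matrix (Fin m) (Fin m) ℂ) :
    Matrix (BIdx nn × Fin m) (BIdx nn × Fin m) ℂ :=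
  fun p q => if p.1 = q.1 then U p.1.1 p.2 q.2 else 0

/-- `p(U₁,…,U_d) = c · det(I_n ⊗ I_m − (K ⊗ I_m)(⊕_{j=1}^d I_{n_j} ⊗ U_j))`. -/
noncomputable def ncDet {d : ℕ} (nn : Fin d → ℕ)
    (K : Matrix (BIdx nn) (BIdx nn) ℂ) (c : ℂ) {m : ℕ}
    (U : ∀ _ : Fin d, Matrix (Fin m) (Fin m) ℂ) : ℂ :=
  c * Matrix.det ((1 : Matrix (BIdx nn × Fin m) (BIdx nn × Fin m) ℂ) -
      (K ⊗ₖ (1 : Matrix (Fin m) (Fin m) ℂ)) * oplusKron nn U)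

/-- A diagonal signature matrix: a diagonal matrix with each diagonal entry `1` or `-1`. -/
def IsDiagSignature {ι : Type*} [DecidableEq ι] (J : Matrix ι ι ℂ) : Prop :=
  ∃ e : ι → ℂ, (∀ i, e i = 1 ∨ e i = -1) ∧ J = Matrix.diagonal e

/-- There is an invertible block diagonal `S = ⊕_{j=1}^d S_j` such that `S⁻¹ K S` is a
strict `J`-contraction (`J - (S⁻¹KS) J (S⁻¹KS)* ≻ 0`) for some diagonal signature matrix `J`. -/
noncomputable def StructSimStrictContr {d : ℕ} (nn : Fin d → ℕ)
    (K : Matrix (BIdx nn) (BIdx nn) ℂ) : Prop :=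
  ∃ S : ∀ j : Fin d, Matrix (Fin (nn j)) (Fin (nn j)) ℂ,
    IsUnit (Matrix.blockDiagonal' S) ∧
    ∃ J : Matrix (BIdx nn) (BIdx nn) ℂ, IsDiagSignature J ∧
      (J - ((Matrix.blockDiagonal' S)⁻¹ * K * Matrix.blockDiagonal' S) * J *
        ((Matrix.blockDiagonal' S)⁻¹ * K * Matrix.blockDiagonal' S)ᴴ).PosDef

section oplusKron

variable {d : ℕ} {nn : Fin d → ℕ} {m : ℕ} (U : ∀ _ : Fin d, Matrix (Fin m) (Fin m) ℂ)

/-- `⊕_j I_{n_j} ⊗ U_j` commutes with `S ⊗ I_m` when `S` is block diagonal. -/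
theorem oplusKron_mul_kronecker_one_comm {S : Matrix (BIdx nn) (BIdx nn) ℂ}
    (hS : ∀ p q : BIdx nn, p.1 ≠ q.1 → S p q = 0) :
    oplusKron nn U * (S ⊗ₖ (1 : Matrix (Fin m) (Fin m) ℂ)) =
      (S ⊗ₖ (1 : Matrix (Fin m) (Fin m) ℂ)) * oplusKron nn U := by
  ext ⟨p, a⟩ ⟨q, b⟩
  simp only [mul_apply, oplusKron, kroneckerMap_apply, Fintype.sum_prod_type, one_apply, ite_mul,
    mul_ite, zero_mul, mul_zero, mul_one, Finset.sum_ite_irrel, Finset.sum_const_zero,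
    Finset.sum_ite_eq, Finset.sum_ite_eq', Finset.mem_univ, if_true]
  by_cases h : p.1 = q.1
  · rw [h, mul_comm]
  · simp [hS p q h]

theorem oplusKron_mul_conjTranspose (hU : ∀ j, U j ∈ Matrix.unitaryGroup (Fin m) ℂ) :
    oplusKron nn U * (oplusKron nn U)ᴴ = 1 := by
  ext ⟨p, a⟩ ⟨q, b⟩
  have h := congrFun (congrFun (mem_unitaryGroup_iff.mp (hU p.1)) a) b
  simp only [mul_apply, star_apply] at h
  by_cases hpq : p = q
  · subst hpq
    simpa [mul_apply, oplusKron, Fintype.sum_prod_type, one_apply, apply_ite star, ite_mul,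
      mul_ite, Finset.sum_ite_irrel] using h
  · simp [mul_apply, oplusKron, Fintype.sum_prod_type, one_apply, apply_ite star, ite_mul,
      mul_ite, Finset.sum_ite_irrel, hpq]

end oplusKron

/-- A strict contraction with respect to an indefinite form does not have the eigenvalue `1`. -/
theorem Matrix.PosDef.det_one_sub_ne_zero {ι : Type*} [Fintype ι] [DecidableEq ι]
    {J A : Matrix ι ι ℂ} (h : (J - A * J * Aᴴ).PosDef) : (1 - A).det ≠ 0 := by
  intro h0
  obtain ⟨v, hv, hvA⟩ := exists_vecMul_eq_zero_iff.mpr h0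
  rw [vecMul_sub, vecMul_one, sub_eq_zero] at hvA
  have hs : Aᴴ *ᵥ star v = star v := by rw [← star_vecMul, ← hvA]
  have hpos := h.dotProduct_mulVec_pos (x := star v) (by simpa using hv)
  rw [star_star, sub_mulVec, ← mulVec_mulVec, hs, ← mulVec_mulVec, dotProduct_sub,
    dotProduct_mulVec v A, ← hvA, sub_self] at hpos
  exact lt_irrefl _ hpos

theorem stmt1 {d : ℕ} (nn : Fin d → ℕ) (hnn : ∀ j, 0 < nn j)
    (K : Matrix (BIdx nn) (BIdx nn) ℂ) (c : ℂ) (hc : c ≠ 0)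
    (h : StructSimStrictContr nn K) :
    ∀ (m : ℕ) (U : ∀ _ : Fin d, Matrix (Fin m) (Fin m) ℂ),
      (∀ j, U j ∈ Matrix.unitaryGroup (Fin m) ℂ) → ncDet nn K c U ≠ 0 := by
  intro m U hU
  obtain ⟨S, hS, J, ⟨e, -, rfl⟩, hpos⟩ := h
  refine mul_ne_zero hc ?_
  have hSW := oplusKron_mul_kronecker_one_comm U (S := blockDiagonal' S)
    fun p q hpq => blockDiagonal'_apply_ne S p.2 q.2 hpq
  have hJW := oplusKron_mul_kronecker_one_comm U (S := diagonal e)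
    fun p q hpq => diagonal_apply_ne _ fun hh => hpq (congrArg Sigma.fst hh)
  have hWW := oplusKron_mul_conjTranspose (nn := nn) U hU
  rw [isUnit_iff_isUnit_det] at hS
  generalize blockDiagonal' S = S at *
  generalize oplusKron nn U = W at *
  set T : Matrix (BIdx nn × Fin m) (BIdx nn × Fin m) ℂ := S ⊗ₖ 1
  set L := S⁻¹ * K * S with hL
  have hT : IsUnit T := by
    refine IsUnit.of_mul_eq_one (S⁻¹ ⊗ₖ 1) ?_
    rw [← mul_kronecker_mul, mul_nonsing_inv S hS, one_mul, one_kronecker_one]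
  have hKT : (K ⊗ₖ (1 : Matrix (Fin m) (Fin m) ℂ)) * T = T * (L ⊗ₖ 1) := by
    rw [← mul_kronecker_mul, ← mul_kronecker_mul, hL, ← mul_assoc, ← mul_assoc,
      mul_nonsing_inv S hS, one_mul, one_mul]
  have hconj : (1 - (K ⊗ₖ (1 : Matrix (Fin m) (Fin m) ℂ)) * W) * T =
      T * (1 - (L ⊗ₖ 1) * W) := by
    rw [sub_mul, mul_sub, mul_assoc, hSW, ← mul_assoc, hKT, one_mul, mul_one, mul_assoc]
  have hcontr : ((diagonal e ⊗ₖ (1 : Matrix (Fin m) (Fin m) ℂ)) -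
      ((L ⊗ₖ 1) * W) * (diagonal e ⊗ₖ 1) * ((L ⊗ₖ 1) * W)ᴴ).PosDef := by
    clear_value L
    have hker : (diagonal e ⊗ₖ (1 : Matrix (Fin m) (Fin m) ℂ)) -
        ((L ⊗ₖ 1) * W) * (diagonal e ⊗ₖ 1) * ((L ⊗ₖ 1) * W)ᴴ =
        (diagonal e - L * diagonal e * Lᴴ) ⊗ₖ 1 := by
      rw [sub_eq_iff_eq_add, conjTranspose_mul _ W, mul_assoc (L ⊗ₖ 1) W, hJW, ← mul_assoc,
        ← mul_assoc, mul_assoc _ W, hWW, mul_one, conjTranspose_kronecker, conjTranspose_one,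
        ← mul_kronecker_mul, ← mul_kronecker_mul, one_mul, one_mul, ← add_kronecker,
        sub_add_cancel]
    rw [hker]
    exact hpos.kronecker PosDef.one
  have hdet := congrArg det hconj
  rw [det_mul, det_mul, mul_comm] at hdet
  rw [mul_left_cancel₀ ((isUnit_iff_isUnit_det T).mp hT).ne_zero hdet]
  exact hcontr.det_one_sub_ne_zero
end

section
/- Let K ∈ ℂ^{n×n} with n = n₁+⋯+n_d and let c ∈ ℂ be nonzero. If c·det(I_n ⊗ I_m − (K ⊗ I_m)(⊕_{j=1}^d I_{n_j} ⊗ U_j)) ≠ 0 for every m ∈ {1,…,n} and every d-tuple (U₁,…,U_d) of m×m unitary matrices, then there exists an invertible block diagonal matrix S = ⊕_{j=1}^d S_j with S_j ∈ ℂ^{n_j×n_j} such that S⁻¹KS is a strict J-contraction for some diagonal signature matrix J. -/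
open Matrix Kronecker
open scoped ComplexOrder

section StrictlyAccretive

variable {ι : Type*} [Fintype ι]

/-- The set of complex matrices whose Hermitian part is positive definite. -/
def strictlyAccretive (ι : Type*) [Fintype ι] : Set (Matrix ι ι ℂ) :=
  {A | ∀ x : ι → ℂ, x ≠ 0 → 0 < (star x ⬝ᵥ A *ᵥ x).re}

theorem isOpen_strictlyAccretive : IsOpen (strictlyAccretive ι) := by
  rw [isOpen_iff_eventually]
  intro A hA
  have key : ∀ᶠ B in nhds A, ∀ x ∈ Metric.sphere (0 : ι → ℂ) 1,
      0 < (star x ⬝ᵥ B *ᵥ x).re := by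
    refine (isCompact_sphere _ _).eventually_forall_of_forall_eventually fun x hx => ?_
    have hcont : Continuous fun z : Matrix ι ι ℂ × (ι → ℂ) =>
        (star z.2 ⬝ᵥ z.1 *ᵥ z.2).re := by fun_prop
    exact hcont.continuousAt.eventually (lt_mem_nhds (hA x (ne_zero_of_mem_unit_sphere ⟨x, hx⟩)))
  filter_upwards [key] with B hB x hx
  have hn : ‖x‖ ≠ 0 := norm_ne_zero_iff.2 hx
  have h := hB (((‖x‖⁻¹ : ℝ) : ℂ) • x) (by simp [norm_smul, hn])
  rw [star_smul, smul_dotProduct, mulVec_smul, dotProduct_smul, smul_eq_mul, smul_eq_mul,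
    Complex.star_def, Complex.conj_ofReal, Complex.re_ofReal_mul, Complex.re_ofReal_mul] at h
  have hp : 0 ≤ ‖x‖⁻¹ := by positivity
  exact pos_of_mul_pos_right (pos_of_mul_pos_right h hp) hp

theorem convex_strictlyAccretive : Convex ℝ (strictlyAccretive ι) := by
  intro A hA B hB a b ha hb hab x hx
  have h1 := hA x hx
  have h2 := hB x hx
  simp only [add_mulVec, smul_mulVec, dotProduct_add, dotProduct_smul, Complex.add_re,
    Complex.smul_re, smul_eq_mul]
  rcases ha.eq_or_lt with rfl | ha
  · have : b = 1 := by linarith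
    subst this; simpa using h2
  · have := mul_pos ha h1
    have := mul_nonneg hb h2.le
    linarith

theorem posDef_of_mem_strictlyAccretive {A : Matrix ι ι ℂ} (hA : A ∈ strictlyAccretive ι)
    (hH : A.IsHermitian) : A.PosDef := by
  refine .of_dotProduct_mulVec_pos hH fun x hx => Complex.pos_iff.2 ⟨hA x hx, ?_⟩
  exact (hH.im_star_dotProduct_mulVec_self x).symm

theorem Matrix.PosDef.mem_strictlyAccretive {A : Matrix ι ι ℂ} (hA : A.PosDef) :
    A ∈ strictlyAccretive ι :=
  fun _ hx => (Complex.pos_iff.1 (hA.dotProduct_mulVec_pos hx)).1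

theorem add_mem_strictlyAccretive_of_skew {A N : Matrix ι ι ℂ} (hA : A ∈ strictlyAccretive ι)
    (hN : Nᴴ = -N) : A + N ∈ strictlyAccretive ι := by
  intro x hx
  have h : star (star x ⬝ᵥ N *ᵥ x) = -(star x ⬝ᵥ N *ᵥ x) := by
    rw [← star_dotProduct_star, star_star, star_mulVec, hN, ← dotProduct_mulVec, neg_mulVec,
      dotProduct_neg]
  have h' := congrArg Complex.re h
  simp only [Complex.star_def, Complex.conj_re, Complex.neg_re] at h'
  have := hA x hx
  rw [add_mulVec, dotProduct_add, Complex.add_re]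
  linarith

theorem posDef_add_conjTranspose_of_mem_strictlyAccretive {A : Matrix ι ι ℂ}
    (hA : A ∈ strictlyAccretive ι) : (A + Aᴴ).PosDef := by
  refine posDef_of_mem_strictlyAccretive ?_ (isHermitian_add_transpose_self A)
  have := add_mem_strictlyAccretive_of_skew (N := Aᴴ - A) hA (by simp)
  intro x hx
  have h1 := hA x hx
  have h2 := this x hx
  rw [add_sub_cancel] at h2
  rw [add_mulVec, dotProduct_add, Complex.add_re]
  linarith

/-- A subspace of matrices avoiding the strictly accretive ones is annihilated, for the trace
pairing, by a nonzero positive semidefinite matrix. -/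
theorem exists_posSemidef_trace_eq_zero [DecidableEq ι] (L : Submodule ℂ (Matrix ι ι ℂ))
    (hL : Disjoint (strictlyAccretive ι) L) :
    ∃ P : Matrix ι ι ℂ, P.PosSemidef ∧ P ≠ 0 ∧ ∀ A ∈ L, (P * A).trace = 0 := by
  obtain ⟨f, u, hC, hu⟩ := RCLike.geometric_hahn_banach_open (𝕜 := ℂ) convex_strictlyAccretive
    isOpen_strictlyAccretive (L.restrictScalars ℝ).convex hL
  simp only [RCLike.re_to_complex] at hC hu
  have hone : (1 : Matrix ι ι ℂ) ∈ strictlyAccretive ι := PosDef.one.mem_strictlyAccretive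
  have hfL : ∀ A ∈ L, f A = 0 := by
    intro A hA
    have hre : ∀ B ∈ L, (f B).re = 0 := by
      intro B hB
      by_contra hne
      have := hu (((u - 1) / (f B).re : ℝ) • B) (L.smul_of_tower_mem _ hB)
      rw [← Complex.coe_smul, map_smul, smul_eq_mul, Complex.re_ofReal_mul,
        div_mul_cancel₀ _ hne] at this
      linarith
    refine Complex.ext (hre A hA) ?_
    simpa using hre (Complex.I • A) (L.smul_mem _ hA)
  have hu0 : u ≤ 0 := by simpa using hu 0 L.zero_mem
  have hneg : ∀ A ∈ strictlyAccretive ι, (f A).re < 0 := fun A hA => (hC A hA).trans_le hu0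
  have hskew : ∀ N : Matrix ι ι ℂ, Nᴴ = -N → (f N).re = 0 := by
    intro N hN
    by_contra hne
    have := hneg _ (add_mem_strictlyAccretive_of_skew
      (N := ((-(f 1).re / (f N).re : ℝ) : ℂ) • N) hone (by
        rw [conjTranspose_smul, hN, Complex.star_def, Complex.conj_ofReal, smul_neg]))
    rw [map_add, map_smul, smul_eq_mul, Complex.add_re, Complex.re_ofReal_mul,
      div_mul_cancel₀ _ hne] at this
    linarith
  have hstar : ∀ A : Matrix ι ι ℂ, f Aᴴ = star (f A) := by
    intro A
    have h1 := hskew (A - Aᴴ) (by simp)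
    have h2 := hskew (Complex.I • (A + Aᴴ)) (by
      simp [conjTranspose_smul, add_comm])
    simp at h1 h2
    apply Complex.ext
    · simp; linarith
    · simp; linarith
  let P : Matrix ι ι ℂ := Matrix.of fun i j => -f (Matrix.single j i 1)
  have hP : ∀ A, (P * A).trace = -f A := by
    intro A
    conv_rhs => rw [matrix_eq_sum_single A]
    simp only [trace, diag, mul_apply, map_sum]
    rw [Finset.sum_comm, ← Finset.sum_neg_distrib]
    refine Finset.sum_congr rfl fun i _ => ?_
    rw [← Finset.sum_neg_distrib]
    refine Finset.sum_congr rfl fun j _ => ?_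
    have : Matrix.single i j (A i j) = A i j • Matrix.single i j (1 : ℂ) := by simp
    rw [this, map_smul]
    simp [P, mul_comm]
  refine ⟨P, ?_, ?_, fun A hA => by rw [hP, hfL A hA, neg_zero]⟩
  · refine .of_dotProduct_mulVec_nonneg ?_ ?_
    · ext i j
      simp [P, ← hstar]
    · intro x
      have hx : star x ⬝ᵥ P *ᵥ x = -f (vecMulVec x (star x)) := by
        rw [← hP, mul_vecMulVec, trace_vecMulVec, dotProduct_comm]
      have hB : (vecMulVec x (star x))ᴴ = vecMulVec x (star x) := by
        rw [conjTranspose_vecMulVec, star_star]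
      rw [hx, Complex.nonneg_iff]
      constructor
      · refine le_of_forall_pos_lt_add fun ε hε => ?_
        have hf1 := hneg 1 hone
        have hδ : 0 < ε / -(f 1).re := div_pos hε (by linarith)
        have h := hneg _ (PosDef.posSemidef_add (posSemidef_vecMulVec_self_star x)
          (PosDef.one.smul hδ)).mem_strictlyAccretive
        rw [← Complex.coe_smul, map_add, map_smul, smul_eq_mul, Complex.add_re,
          Complex.re_ofReal_mul, div_neg, neg_mul, div_mul_cancel₀ _ hf1.ne] at h
        rw [Complex.neg_re]
        linarith
      · have := congrArg Complex.im (hB ▸ hstar (vecMulVec x (star x)))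
        simp at this ⊢
        linarith
  · intro h0
    have := hneg 1 hone
    have h1 := hP 1
    rw [h0, zero_mul, trace_zero] at h1
    rw [neg_eq_zero.1 h1.symm] at this
    simp at this

end StrictlyAccretive

section Factorizations

variable {ι κ : Type*} [Fintype ι] [DecidableEq ι] [Fintype κ] [DecidableEq κ]

/-- Two matrices with the same Gram matrix `A * Aᴴ` differ by a unitary factor on the right. -/
theorem exists_unitary_of_mul_conjTranspose_eq {A B : Matrix ι κ ℂ}
    (h : A * Aᴴ = B * Bᴴ) : ∃ V ∈ Matrix.unitaryGroup κ ℂ, B = A * V := by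
  have hnorm : ∀ v, ‖toEuclideanLin Aᴴ v‖ = ‖toEuclideanLin Bᴴ v‖ := by
    intro v
    have key : ∀ C : Matrix ι κ ℂ, ((‖toEuclideanLin Cᴴ v‖ ^ 2 : ℝ) : ℂ)
        = star v.ofLp ⬝ᵥ (C * Cᴴ) *ᵥ v.ofLp := by
      intro C
      have h1 := inner_self_eq_norm_sq_to_K (𝕜 := ℂ) (toEuclideanLin Cᴴ v)
      rw [EuclideanSpace.inner_eq_star_dotProduct] at h1
      rw [Complex.ofReal_pow]
      refine h1.symm.trans ?_
      simp only [toLpLin_apply, star_mulVec, ← mulVec_mulVec, conjTranspose_conjTranspose]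
      rw [dotProduct_comm, ← dotProduct_mulVec]
    have h2 : ((‖toEuclideanLin Aᴴ v‖ ^ 2 : ℝ) : ℂ) = ((‖toEuclideanLin Bᴴ v‖ ^ 2 : ℝ) : ℂ) := by
      rw [key, key, h]
    exact (pow_left_inj₀ (norm_nonneg _) (norm_nonneg _) two_ne_zero).1
      (Complex.ofReal_injective h2)
  set f := toEuclideanLin Aᴴ
  set g := toEuclideanLin Bᴴ with hg
  obtain ⟨s, hs⟩ := f.rangeRestrict.exists_rightInverse_of_surjective f.range_rangeRestrict
  have hfs : ∀ y : LinearMap.range f, f (s y) = y := fun y =>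
    congrArg Subtype.val (LinearMap.congr_fun hs y)
  let L : LinearMap.range f →ₗᵢ[ℂ] EuclideanSpace ℂ κ :=
    { toLinearMap := g ∘ₗ s
      norm_map' := fun y => by
        rw [LinearMap.comp_apply, ← hnorm, hfs, Submodule.coe_norm] }
  have hL : ∀ v, L.extend (f v) = g v := by
    intro v
    have h1 := L.extend_apply ⟨f v, v, rfl⟩
    refine h1.trans ?_
    change g (s _) = g v
    rw [← sub_eq_zero, ← map_sub, ← norm_eq_zero, ← hnorm, map_sub, hfs, sub_self, norm_zero]
  let M : Matrix κ κ ℂ := toEuclideanLin.symm L.extend.toLinearMap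
  have hM : toEuclideanLin M = L.extend.toLinearMap := LinearEquiv.apply_symm_apply _ _
  have hMA : M * Aᴴ = Bᴴ := by
    apply toEuclideanLin.injective
    refine LinearMap.ext fun v => ?_
    rw [← hg, ← hL, toLpLin_mul_same]
    rw [LinearMap.comp_apply, hM]
    rfl
  have hMM : Mᴴ * M = 1 := by
    apply toEuclideanLin.injective
    refine LinearMap.ext fun v => ext_inner_left ℂ fun w => ?_
    rw [toLpLin_mul_same, toEuclideanLin_conjTranspose_eq_adjoint, LinearMap.comp_apply,
      LinearMap.adjoint_inner_right, hM]
    simp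
  refine ⟨Mᴴ, ?_, ?_⟩
  · rw [mem_unitaryGroup_iff, star_eq_conjTranspose, conjTranspose_conjTranspose, hMM]
  · rw [← conjTranspose_conjTranspose B, ← hMA, conjTranspose_mul, conjTranspose_conjTranspose]

open scoped MatrixOrder in
theorem Matrix.PosSemidef.exists_eq_mul_conjTranspose {P : Matrix ι ι ℂ} (hP : P.PosSemidef) :
    ∃ Q : Matrix ι ι ℂ, P = Q * Qᴴ :=
  CStarAlgebra.nonneg_iff_eq_mul_star_self.1 hP.nonneg

/-- Sylvester's law for invertible Hermitian matrices: they are congruent to a signature matrix. -/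
theorem Matrix.IsHermitian.exists_signature_congruence {H : Matrix ι ι ℂ} (hH : H.IsHermitian)
    (hu : IsUnit H) : ∃ (S : Matrix ι ι ℂ) (e : ι → ℂ), IsUnit S ∧ (∀ i, e i = 1 ∨ e i = -1) ∧
      H = S * diagonal e * Sᴴ := by
  have hne : ∀ i, hH.eigenvalues i ≠ 0 := by
    have := (isUnit_iff_isUnit_det _).1 hu
    rw [hH.det_eq_prod_eigenvalues, isUnit_iff_ne_zero, Finset.prod_ne_zero_iff] at this
    exact fun i hi => this i (Finset.mem_univ i) (by simp [hi])
  let r : ι → ℂ := fun i => (Real.sqrt |hH.eigenvalues i| : ℝ)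
  let e : ι → ℂ := fun i => (SignType.sign (hH.eigenvalues i) : ℝ)
  let W : Matrix ι ι ℂ := hH.eigenvectorUnitary
  have hdiag : diagonal r * diagonal e * (diagonal r)ᴴ
      = diagonal (RCLike.ofReal ∘ hH.eigenvalues : ι → ℂ) := by
    rw [diagonal_conjTranspose, diagonal_mul_diagonal, diagonal_mul_diagonal]
    congr 1
    funext i
    simp only [r, e, Pi.star_apply, Complex.star_def, Complex.conj_ofReal, Function.comp]
    rw [mul_right_comm, ← Complex.ofReal_mul, ← Complex.ofReal_mul,
      Real.mul_self_sqrt (abs_nonneg _), abs_mul_sign]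
    rfl
  refine ⟨W * diagonal r, e, ?_, ?_, ?_⟩
  · refine IsUnit.mul (Unitary.isUnit_coe) ?_
    rw [isUnit_diagonal, Pi.isUnit_iff]
    exact fun i => by simp [r, hne i]
  · intro i
    rcases lt_or_gt_of_ne (hne i) with h | h
    · exact Or.inr (by simp [e, sign_neg h])
    · exact Or.inl (by simp [e, sign_pos h])
  · conv_lhs => rw [hH.spectral_theorem]
    rw [Unitary.conjStarAlgAut_apply, ← hdiag, conjTranspose_mul]
    simp only [W, Matrix.mul_assoc, star_eq_conjTranspose]

end Factorizations

section BlockStructure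

variable {d : ℕ} {nn : Fin d → ℕ} {K : Matrix (BIdx nn) (BIdx nn) ℂ}

theorem isUnit_blockDiagonal' {S : ∀ j : Fin d, Matrix (Fin (nn j)) (Fin (nn j)) ℂ}
    (hS : ∀ j, IsUnit (S j)) : IsUnit (blockDiagonal' S) := by
  refine IsUnit.of_mul_eq_one (blockDiagonal' fun j => (S j)⁻¹) ?_
  rw [← blockDiagonal'_mul, ← blockDiagonal'_one]
  congr 1
  funext j
  exact mul_nonsing_inv _ ((isUnit_iff_isUnit_det _).1 (hS j))

theorem structSimStrictContr_of_isUnit {H : ∀ j : Fin d, Matrix (Fin (nn j)) (Fin (nn j)) ℂ}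
    (hH : ∀ j, (H j).IsHermitian) (hu : ∀ j, IsUnit (H j))
    (hpos : (blockDiagonal' H - K * blockDiagonal' H * Kᴴ).PosDef) :
    StructSimStrictContr nn K := by
  choose S e hS he hSe using fun j => (hH j).exists_signature_congruence (hu j)
  refine ⟨S, isUnit_blockDiagonal' hS, diagonal fun p => e p.1 p.2,
    ⟨_, fun p => he p.1 p.2, rfl⟩, ?_⟩
  set T := blockDiagonal' S with hT
  have hTu : IsUnit T := isUnit_blockDiagonal' hS
  have hTd : IsUnit T.det := (isUnit_iff_isUnit_det _).1 hTu
  have hHT : blockDiagonal' H = T * diagonal (fun p : BIdx nn => e p.1 p.2) * Tᴴ := by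
    rw [hT, blockDiagonal'_conjTranspose, ← blockDiagonal'_diagonal, ← blockDiagonal'_mul,
      ← blockDiagonal'_mul]
    exact congrArg _ (funext hSe)
  set J := diagonal (fun p : BIdx nn => e p.1 p.2)
  rw [← hTu.posDef_star_right_conjugate_iff]
  convert hpos using 1
  rw [hHT, star_eq_conjTranspose]
  simp only [mul_sub, sub_mul, conjTranspose_mul, conjTranspose_nonsing_inv, Matrix.mul_assoc]
  rw [mul_nonsing_inv_cancel_left _ _ hTd, nonsing_inv_mul _ (by simpa using hTd.star), mul_one]

theorem structSimStrictContr_of_mem_strictlyAccretive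
    {H : ∀ j : Fin d, Matrix (Fin (nn j)) (Fin (nn j)) ℂ}
    (hpos : blockDiagonal' H - K * blockDiagonal' H * Kᴴ ∈ strictlyAccretive (BIdx nn)) :
    StructSimStrictContr nn K := by
  let G : ∀ j : Fin d, Matrix (Fin (nn j)) (Fin (nn j)) ℂ := fun j => H j + (H j)ᴴ
  have hG : ∀ j, (G j).IsHermitian := fun j => isHermitian_add_transpose_self _
  have hGpos : (blockDiagonal' G - K * blockDiagonal' G * Kᴴ).PosDef := by
    have := posDef_add_conjTranspose_of_mem_strictlyAccretive hpos
    convert this using 1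
    have hbG : blockDiagonal' G = blockDiagonal' H + (blockDiagonal' H)ᴴ := by
      rw [blockDiagonal'_conjTranspose, ← blockDiagonal'_add]; rfl
    rw [hbG]
    simp only [conjTranspose_sub, conjTranspose_mul, conjTranspose_conjTranspose, mul_add,
      add_mul, Matrix.mul_assoc]
    abel
  have hnhds : {t : ℝ | (blockDiagonal' G - K * blockDiagonal' G * Kᴴ) + t • (1 - K * Kᴴ) ∈
      strictlyAccretive (BIdx nn)} ∈ nhds 0 := by
    refine (isOpen_strictlyAccretive.preimage (by fun_prop)).mem_nhds ?_
    simpa using hGpos.mem_strictlyAccretive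
  obtain ⟨t, ht, hts⟩ := (infinite_of_mem_nhds _ hnhds).exists_notMem_finite
    (Set.finite_iUnion fun j => (-G j).finite_real_spectrum)
  simp only [Set.mem_iUnion, not_exists, spectrum.notMem_iff] at hts
  have hherm : ∀ j, (G j + algebraMap ℝ (Matrix (Fin (nn j)) (Fin (nn j)) ℂ) t).IsHermitian := by
    intro j
    refine (hG j).add ?_
    rw [Algebra.algebraMap_eq_smul_one]
    simp [IsHermitian, conjTranspose_smul]
  refine structSimStrictContr_of_isUnit (H := fun j => G j + algebraMap ℝ _ t) hherm
    (fun j => by simpa [add_comm] using hts j) ?_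
  have hb : (blockDiagonal' fun j => G j + algebraMap ℝ _ t)
      = blockDiagonal' G + t • (1 : Matrix (BIdx nn) (BIdx nn) ℂ) := by
    rw [← blockDiagonal'_one, ← blockDiagonal'_smul, ← blockDiagonal'_add]
    congr 1
    funext j
    simp [Algebra.algebraMap_eq_smul_one]
  refine posDef_of_mem_strictlyAccretive ?_ ?_
  · have heq : blockDiagonal' G + t • (1 : Matrix (BIdx nn) (BIdx nn) ℂ)
          - K * (blockDiagonal' G + t • (1 : Matrix (BIdx nn) (BIdx nn) ℂ)) * Kᴴ
        = (blockDiagonal' G - K * blockDiagonal' G * Kᴴ) + t • (1 - K * Kᴴ) := by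
      simp only [mul_add, add_mul, smul_sub, mul_smul_comm, smul_mul_assoc, mul_one]
      abel
    rw [hb, heq]
    exact ht
  · have := isHermitian_blockDiagonal'_iff.2 hherm
    exact this.sub (isHermitian_mul_mul_conjTranspose K this)

/-- A common solution of the blockwise identity `P_{jj} = (Kᴴ P K)_{jj}` produces unitary matrices
at which the determinant vanishes. -/
theorem exists_unitary_ncDet_eq_zero {N : ℕ} (c : ℂ) {X : Matrix (BIdx nn) (Fin N) ℂ}
    (hX : X ≠ 0) (hP : ∀ j a b, (X * Xᴴ) ⟨j, a⟩ ⟨j, b⟩ = (Kᴴ * (X * Xᴴ) * K) ⟨j, a⟩ ⟨j, b⟩) :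
    ∃ U : ∀ _ : Fin d, Matrix (Fin N) (Fin N) ℂ,
      (∀ j, U j ∈ Matrix.unitaryGroup (Fin N) ℂ) ∧ ncDet nn K c U = 0 := by
  have hblock : ∀ j : Fin d, ∃ V ∈ Matrix.unitaryGroup (Fin N) ℂ,
      X.submatrix (Sigma.mk j) id = (Kᴴ * X).submatrix (Sigma.mk j) id * V := by
    intro j
    apply exists_unitary_of_mul_conjTranspose_eq
    ext a b
    have hY : Kᴴ * (X * Xᴴ) * K = (Kᴴ * X) * (Kᴴ * X)ᴴ := by
      simp [conjTranspose_mul, Matrix.mul_assoc]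
    have := hP j a b
    rw [hY] at this
    exact this.symm
  choose V hV hXV using hblock
  refine ⟨fun j => (V j).map star, fun j => ?_, ?_⟩
  · have h1 := congrArg (fun A => A.map (starRingEnd ℂ)) (mem_unitaryGroup_iff.1 (hV j))
    rw [mem_unitaryGroup_iff]
    simp only [Matrix.map_mul] at h1
    rw [Matrix.map_one _ (map_zero _) (map_one _)] at h1
    exact h1
  · rw [ncDet, mul_eq_zero]
    right
    rw [← star_eq_zero, ← det_conjTranspose]
    refine exists_mulVec_eq_zero_iff.1 ⟨fun p => X p.1 p.2, ?_, ?_⟩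
    · intro h0
      exact hX (Matrix.ext fun p k => congrFun h0 (p, k))
    · have hK : (K ⊗ₖ (1 : Matrix (Fin N) (Fin N) ℂ))ᴴ *ᵥ (fun p => X p.1 p.2)
          = fun p => (Kᴴ * X) p.1 p.2 := by
        funext p
        simp [mulVec, dotProduct, Fintype.sum_prod_type, kroneckerMap_apply, one_apply, mul_apply,
          apply_ite (starRingEnd ℂ)]
      rw [conjTranspose_sub, conjTranspose_one, conjTranspose_mul, sub_mulVec, one_mulVec,
        ← mulVec_mulVec, hK, sub_eq_zero]
      funext ⟨⟨j, a⟩, k⟩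
      have := congrFun (congrFun (hXV j) a) k
      simp only [submatrix_apply, id] at this
      rw [this, mul_apply, mulVec, dotProduct, Fintype.sum_prod_type,
        Finset.sum_eq_single (⟨j, a⟩ : BIdx nn)]
      · simp [oplusKron, mul_comm]
      · intro q _ hq
        simp [oplusKron, hq]
      · simp

/-- The matrices `H - K H Kᴴ` with `H` block diagonal. -/
def steinRange (nn : Fin d → ℕ) (K : Matrix (BIdx nn) (BIdx nn) ℂ) :
    Submodule ℂ (Matrix (BIdx nn) (BIdx nn) ℂ) where
  carrier := Set.range fun H : ∀ j : Fin d, Matrix (Fin (nn j)) (Fin (nn j)) ℂ =>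
    blockDiagonal' H - K * blockDiagonal' H * Kᴴ
  zero_mem' := ⟨0, by simp⟩
  add_mem' := by
    rintro _ _ ⟨H, rfl⟩ ⟨H', rfl⟩
    exact ⟨H + H', by simp only [blockDiagonal'_add, mul_add, add_mul]; abel⟩
  smul_mem' := by
    rintro a _ ⟨H, rfl⟩
    exact ⟨a • H, by simp only [blockDiagonal'_smul, mul_smul_comm, smul_mul_assoc, smul_sub]⟩

theorem single_sub_mem_steinRange (j : Fin d) (a b : Fin (nn j)) :
    single (⟨j, a⟩ : BIdx nn) (⟨j, b⟩ : BIdx nn) (1 : ℂ)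
        - K * single (⟨j, a⟩ : BIdx nn) (⟨j, b⟩ : BIdx nn) 1 * Kᴴ ∈
      steinRange nn K := by
  refine ⟨Pi.single j (single a b 1), ?_⟩
  have : blockDiagonal' (Pi.single j (single a b (1 : ℂ)))
      = single (⟨j, a⟩ : BIdx nn) (⟨j, b⟩ : BIdx nn) (1 : ℂ) := by
    ext ⟨i, a'⟩ ⟨i', b'⟩
    by_cases hi : i = i'
    · subst hi
      rw [blockDiagonal'_apply_eq]
      by_cases hj : j = i
      · subst hj
        simp [single_apply]
      · rw [Pi.single_eq_of_ne (Ne.symm hj)]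
        simp [hj]
    · rw [blockDiagonal'_apply_ne _ _ _ hi]
      simp only [single_apply]
      rw [if_neg]
      rintro ⟨h1, h2⟩
      exact hi ((congrArg Sigma.fst h1).symm.trans (congrArg Sigma.fst h2))
  simp only [this]

end BlockStructure

theorem stmt2 {d : ℕ} (nn : Fin d → ℕ) (hnn : ∀ j, 0 < nn j)
    (K : Matrix (BIdx nn) (BIdx nn) ℂ) (c : ℂ) (hc : c ≠ 0)
    (h : ∀ (m : ℕ), 1 ≤ m → m ≤ ∑ j, nn j →
      ∀ U : ∀ _ : Fin d, Matrix (Fin m) (Fin m) ℂ,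
        (∀ j, U j ∈ Matrix.unitaryGroup (Fin m) ℂ) → ncDet nn K c U ≠ 0) :
    StructSimStrictContr nn K := by
  by_cases hL : Disjoint (strictlyAccretive (BIdx nn)) (steinRange nn K)
  · exfalso
    obtain ⟨P, hPpos, hP0, hPL⟩ := exists_posSemidef_trace_eq_zero _ hL
    obtain ⟨Q, hQ⟩ := hPpos.exists_eq_mul_conjTranspose
    let X : Matrix (BIdx nn) (Fin (∑ j, nn j)) ℂ := Q.submatrix id finSigmaFinEquiv.symm
    have hXP : X * Xᴴ = P := by
      rw [hQ, conjTranspose_submatrix, submatrix_mul_equiv]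
      rfl
    have hX : X ≠ 0 := by
      rintro h0
      rw [h0, Matrix.zero_mul] at hXP
      exact hP0 hXP.symm
    have hN : 1 ≤ ∑ j, nn j := by
      by_contra hlt
      have : ∑ j, nn j = 0 := by omega
      exact hX (Matrix.ext fun p k => (Fin.cast this k).elim0)
    obtain ⟨U, hU, hdet⟩ := exists_unitary_ncDet_eq_zero (K := K) c hX fun j a b => by
      have h1 := hPL _ (single_sub_mem_steinRange (K := K) j b a)
      rw [mul_sub, trace_sub, sub_eq_zero, ← Matrix.mul_assoc, trace_mul_comm _ Kᴴ,
        ← Matrix.mul_assoc, ← Matrix.mul_assoc, trace_mul_single, trace_mul_single] at h1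
      simpa [hXP] using h1
    exact h _ hN le_rfl U hU hdet
  · rw [Set.not_disjoint_iff] at hL
    obtain ⟨_, hA, H, rfl⟩ := hL
    exact structSimStrictContr_of_mem_strictlyAccretive hA
end

section
/- Let K ∈ ℂ^{n×n} with n = n₁+⋯+n_d, let L be positive semidefinite, factored as L = XX* with X ∈ ℂ^{n×m}, write X = col(X₁,…,X_d) with X_j ∈ ℂ^{n_j×m}, and write K*X = col(Y₁,…,Y_d) with Y_j ∈ ℂ^{n_j×m}. Then L ∈ 𝒲_K^⊥ if and only if X_j X_j* = Y_j Y_j* for j = 1,…,d. -/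
open Matrix Kronecker
open scoped ComplexOrder

/-- The real subspace `𝒲_K = {⊕_j H_j − K (⊕_j H_j) K* : H_j Hermitian}` of `ℋ_n`. -/
def WK {d : ℕ} (nn : Fin d → ℕ) (K : Matrix (BIdx nn) (BIdx nn) ℂ) :
    Set (Matrix (BIdx nn) (BIdx nn) ℂ) :=
  { W | ∃ H : ∀ j : Fin d, Matrix (Fin (nn j)) (Fin (nn j)) ℂ,
      (∀ j, (H j).IsHermitian) ∧
      W = Matrix.blockDiagonal' H - K * Matrix.blockDiagonal' H * Kᴴ }

/-- The orthogonal complement `𝒲_K^⊥` of `𝒲_K` inside the Hermitian matrices `ℋ_n`,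
with respect to the trace inner product `⟨A,B⟩ = Tr(AB)`. -/
def WKperp {d : ℕ} (nn : Fin d → ℕ) (K : Matrix (BIdx nn) (BIdx nn) ℂ) :
    Set (Matrix (BIdx nn) (BIdx nn) ℂ) :=
  { L | L.IsHermitian ∧ ∀ W ∈ WK nn K, Matrix.trace (L * W) = 0 }

/-- The `j`-th block `X_j ∈ ℂ^{n_j × m}` of `X = col(X₁,…,X_d) ∈ ℂ^{n × m}`. -/
def blk {d : ℕ} (nn : Fin d → ℕ) {m : ℕ} (X : Matrix (BIdx nn) (Fin m) ℂ)
    (j : Fin d) : Matrix (Fin (nn j)) (Fin m) ℂ :=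
  fun a k => X ⟨j, a⟩ k

theorem trace_mul_conjTranspose_mul_blockDiagonal' {d : ℕ} (nn : Fin d → ℕ) {m : ℕ}
    (X : Matrix (BIdx nn) (Fin m) ℂ) (H : ∀ j, Matrix (Fin (nn j)) (Fin (nn j)) ℂ) :
    trace (X * Xᴴ * blockDiagonal' H) = ∑ j, trace (blk nn X j * (blk nn X j)ᴴ * H j) := by
  simp only [trace, diag_apply, mul_apply (M := X * Xᴴ), Fintype.sum_sigma]
  refine Finset.sum_congr rfl fun j _ => Finset.sum_congr rfl fun a _ => ?_
  rw [Finset.sum_eq_single j]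
  · simp only [blockDiagonal'_apply_eq, mul_apply, blk, conjTranspose_apply]
  · intro k _ hk
    simp [blockDiagonal'_apply_ne H _ _ hk]
  · simp

theorem trace_mul_conjTranspose_mul_sub {d : ℕ} (nn : Fin d → ℕ) {m : ℕ}
    (K : Matrix (BIdx nn) (BIdx nn) ℂ) (X : Matrix (BIdx nn) (Fin m) ℂ)
    (H : ∀ j, Matrix (Fin (nn j)) (Fin (nn j)) ℂ) :
    trace (X * Xᴴ * (blockDiagonal' H - K * blockDiagonal' H * Kᴴ)) =
      ∑ j, trace ((blk nn X j * (blk nn X j)ᴴ -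
        blk nn (Kᴴ * X) j * (blk nn (Kᴴ * X) j)ᴴ) * H j) := by
  have hK : trace (X * Xᴴ * (K * blockDiagonal' H * Kᴴ)) =
      trace (Kᴴ * X * (Kᴴ * X)ᴴ * blockDiagonal' H) := by
    rw [← Matrix.mul_assoc, trace_mul_comm]
    simp only [conjTranspose_mul, conjTranspose_conjTranspose, Matrix.mul_assoc]
  rw [Matrix.mul_sub, trace_sub, hK, trace_mul_conjTranspose_mul_blockDiagonal',
    trace_mul_conjTranspose_mul_blockDiagonal', ← Finset.sum_sub_distrib]
  simp only [Matrix.sub_mul, trace_sub]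

theorem stmt6 {d : ℕ} (nn : Fin d → ℕ) (hnn : ∀ j, 0 < nn j)
    (K : Matrix (BIdx nn) (BIdx nn) ℂ) {m : ℕ}
    (X : Matrix (BIdx nn) (Fin m) ℂ)
    (L : Matrix (BIdx nn) (BIdx nn) ℂ) (hL : L = X * Xᴴ) :
    L ∈ WKperp nn K ↔
      ∀ j, blk nn X j * (blk nn X j)ᴴ = blk nn (Kᴴ * X) j * (blk nn (Kᴴ * X) j)ᴴ := by
  subst hL
  constructor
  · rintro ⟨-, h⟩
    have hherm (j) : (blk nn X j * (blk nn X j)ᴴ -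
        blk nn (Kᴴ * X) j * (blk nn (Kᴴ * X) j)ᴴ).IsHermitian :=
      (isHermitian_mul_conjTranspose_self _).sub (isHermitian_mul_conjTranspose_self _)
    have hsum := h _ ⟨_, hherm, rfl⟩
    rw [trace_mul_conjTranspose_mul_sub, Finset.sum_eq_zero_iff_of_nonneg] at hsum
    · intro j
      have hj := hsum j (Finset.mem_univ j)
      nth_rw 1 [← (hherm j).eq] at hj
      exact sub_eq_zero.mp (trace_conjTranspose_mul_self_eq_zero_iff.mp hj)
    · intro j _
      nth_rw 1 [← (hherm j).eq]
      exact (posSemidef_conjTranspose_mul_self _).trace_nonneg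
  · refine fun h => ⟨isHermitian_mul_conjTranspose_self X, ?_⟩
    rintro _ ⟨H, -, rfl⟩
    rw [trace_mul_conjTranspose_mul_sub]
    simp [h]
end

section
/- Let K ∈ ℂ^{n×n} with n = n₁+⋯+n_d. Suppose L is a nonzero positive semidefinite matrix in 𝒲_K^⊥, factored as L = XX* with X ∈ ℂ^{n×m}, X = col(X₁,…,X_d) with X_j ∈ ℂ^{n_j×m}, and let V₁,…,V_d ∈ ℂ^{m×m} be unitary matrices such that the j-th block of K*X equals X_j V_j for each j. Then the vector v ∈ ℂ^{nm}, indexed by pairs (i,k) with 1 ≤ i ≤ n and 1 ≤ k ≤ m and with entries v_{(i,k)} = conj(X_{i,k}), satisfies vᵀ(I_n ⊗ I_m − (K ⊗ I_m)(⊕_{j=1}^d I_{n_j} ⊗ V_jᵀ)) = 0; that is, v lies in the cokernel of I_n ⊗ I_m − (K ⊗ I_m)(⊕_{j=1}^d I_{n_j} ⊗ V_jᵀ). -/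
open Matrix Kronecker
open scoped ComplexOrder

/-- The conjugated entries of `X`, as a row vector, are mapped by `K ⊗ I` to the conjugated
entries of `Kᴴ * X`. -/
theorem star_vecMul_kronecker_one {ι κ : Type*} [Fintype ι] [Fintype κ] [DecidableEq κ]
    (K : Matrix ι ι ℂ) (X : Matrix ι κ ℂ) :
    (fun p : ι × κ => star (X p.1 p.2)) ᵥ* (K ⊗ₖ (1 : Matrix κ κ ℂ)) =
      fun p => star ((Kᴴ * X) p.1 p.2) := by
  ext ⟨l, k⟩
  simp [Matrix.vecMul, dotProduct, Fintype.sum_prod_type, Matrix.kroneckerMap_apply,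
    Matrix.one_apply, Matrix.mul_apply, mul_comm]

theorem vecMul_oplusKron {d : ℕ} (nn : Fin d → ℕ) {m : ℕ}
    (U : ∀ _ : Fin d, Matrix (Fin m) (Fin m) ℂ) (w : BIdx nn × Fin m → ℂ)
    (l : BIdx nn) (t : Fin m) :
    (w ᵥ* oplusKron nn U) (l, t) = ∑ k, w (l, k) * U l.1 k t := by
  simp only [Matrix.vecMul, dotProduct, Fintype.sum_prod_type, oplusKron, mul_ite, mul_zero]
  rw [Finset.sum_eq_single l (fun i _ hi => by simp [hi]) (by simp)]
  simp

theorem stmt11 {d : ℕ} (nn : Fin d → ℕ) (hnn : ∀ j, 0 < nn j)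
    (K : Matrix (BIdx nn) (BIdx nn) ℂ)
    (L : Matrix (BIdx nn) (BIdx nn) ℂ) (hL0 : L ≠ 0)
    (hLperp : L ∈ WKperp nn K) {m : ℕ}
    (X : Matrix (BIdx nn) (Fin m) ℂ) (hLX : L = X * Xᴴ)
    (V : ∀ _ : Fin d, Matrix (Fin m) (Fin m) ℂ)
    (hV : ∀ j, V j ∈ Matrix.unitaryGroup (Fin m) ℂ)
    (hXV : ∀ j, blk nn (Kᴴ * X) j = blk nn X j * V j) :
    (fun p : BIdx nn × Fin m => star (X p.1 p.2)) ᵥ*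
      ((1 : Matrix (BIdx nn × Fin m) (BIdx nn × Fin m) ℂ) -
        (K ⊗ₖ (1 : Matrix (Fin m) (Fin m) ℂ)) * oplusKron nn (fun j => (V j)ᵀ)) = 0 := by
  rw [Matrix.vecMul_sub, Matrix.vecMul_one, sub_eq_zero, ← Matrix.vecMul_vecMul,
    star_vecMul_kronecker_one]
  ext ⟨⟨j, a⟩, t⟩
  rw [vecMul_oplusKron]
  have hblk (k : Fin m) : (Kᴴ * X) ⟨j, a⟩ k = (blk nn X j * V j) a k :=
    congrFun (congrFun (hXV j) a) k
  have hunit : V j * (blk nn X j * V j)ᴴ = (blk nn X j)ᴴ := by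
    have h : V j * (V j)ᴴ = 1 := Matrix.mem_unitaryGroup_iff.mp (hV j)
    rw [Matrix.conjTranspose_mul, ← Matrix.mul_assoc, h, Matrix.one_mul]
  have hentry := congrFun (congrFun hunit t) a
  rw [Matrix.mul_apply] at hentry
  simp only [Matrix.conjTranspose_apply] at hentry
  simp only [hblk, Matrix.transpose_apply]
  rw [show star (X ⟨j, a⟩ t) = star (blk nn X j a t) from rfl, ← hentry]
  exact Finset.sum_congr rfl fun k _ => mul_comm _ _
end
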